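/- For every T > 0, M ≥ 1 and ε ∈ (0,1] there exists a constant C > 0, depending only on M, ε and T, such that every smooth solution (v,u,θ,q) of the radiation hydrodynamics system on [0,T] with (M,ε)-bounded initial data satisfies ‖θ(t,·)‖² + ∫₀ᵗ ∫_𝕋 κ(v,θ)(s,x) θ_x(s,x)²/v(s,x) dx ds ≤ C(1 + 𝔜(t)^{8/(2β+3)}) for all t ∈ [0,T]. -/

import Mathlib

open MeasureTheory Real Set

noncomputable section

namespace RadHydro

/-- Integral over one period `[-1/2, 1/2]` of the torus `𝕋 ≅ ℝ/ℤ`. -/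
def tInt (f : ℝ → ℝ) : ℝ := ∫ x in (-(1/2) : ℝ)..(1/2 : ℝ), f x

/-- Squared `L²` norm over the torus. -/
def L2sq (f : ℝ → ℝ) : ℝ := tInt fun x => (f x) ^ 2

/-- `L^∞` norm over the torus. -/
def Linf (f : ℝ → ℝ) : ℝ := sSup ((fun x => |f x|) '' Icc (-(1/2) : ℝ) (1/2))

/-- Squared `H¹` norm over the torus. -/
def H1sq (f : ℝ → ℝ) : ℝ := L2sq f + L2sq (deriv f)

/-- Squared `H²` norm over the torus. -/
def H2sq (f : ℝ → ℝ) : ℝ := L2sq f + L2sq (deriv f) + L2sq (deriv (deriv f))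

/-- Partial derivative in the time variable. -/
def pt (f : ℝ → ℝ → ℝ) (t x : ℝ) : ℝ := deriv (fun s => f s x) t

/-- Partial derivative in the space variable. -/
def px (f : ℝ → ℝ → ℝ) (t x : ℝ) : ℝ := deriv (f t) x

/-- The heat conductivity `κ(v, θ) = κ₁ + κ₂ v θ^β`. -/
def kappa (κ₁ κ₂ β v θ : ℝ) : ℝ := κ₁ + κ₂ * v * θ ^ β

/-- A smooth solution of the radiation hydrodynamics system (in Lagrangian
coordinates) on `[0, T]`: four `C^∞` functions on `[0,T] × ℝ` (modelled as smooth
functions on all of `ℝ × ℝ`), `1`-periodic in the space variable, with `v > 0`,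
`θ > 0`, satisfying the four equations pointwise for `t ∈ [0, T]`, and with the
normalization `∫_𝕋 v(0, x) dx = 1`. -/
structure Sol (μ R a b κ₁ κ₂ β γ T : ℝ) where
  v : ℝ → ℝ → ℝ
  u : ℝ → ℝ → ℝ
  θ : ℝ → ℝ → ℝ
  q : ℝ → ℝ → ℝ
  smooth_v : ContDiff ℝ (⊤ : ℕ∞) fun p : ℝ × ℝ => v p.1 p.2
  smooth_u : ContDiff ℝ (⊤ : ℕ∞) fun p : ℝ × ℝ => u p.1 p.2
  smooth_θ : ContDiff ℝ (⊤ : ℕ∞) fun p : ℝ × ℝ => θ p.1 p.2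
  smooth_q : ContDiff ℝ (⊤ : ℕ∞) fun p : ℝ × ℝ => q p.1 p.2
  periodic_v : ∀ t, Function.Periodic (v t) 1
  periodic_u : ∀ t, Function.Periodic (u t) 1
  periodic_θ : ∀ t, Function.Periodic (θ t) 1
  periodic_q : ∀ t, Function.Periodic (q t) 1
  v_pos : ∀ t x, 0 < v t x
  θ_pos : ∀ t x, 0 < θ t x
  eq_mass : ∀ t ∈ Icc (0 : ℝ) T, ∀ x : ℝ, pt v t x - px u t x = 0
  eq_mom : ∀ t ∈ Icc (0 : ℝ) T, ∀ x : ℝ,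
    pt u t x + px (fun s y => R * θ s y / v s y) t x
      = px (fun s y => μ * px u s y / v s y) t x
  eq_energy : ∀ t ∈ Icc (0 : ℝ) T, ∀ x : ℝ,
    pt (fun s y => R / (γ - 1) * θ s y + (u s y) ^ 2 / 2) t x
      + px (fun s y => R * θ s y / v s y * u s y) t x + px q t x
      = px (fun s y => μ * u s y * px u s y / v s y) t x
        + px (fun s y => kappa κ₁ κ₂ β (v s y) (θ s y) * px θ s y / v s y) t x
  eq_rad : ∀ t ∈ Icc (0 : ℝ) T, ∀ x : ℝ,
    -px (fun s y => px q s y / v s y) t x + a * v t x * q t x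
      + b * px (fun s y => (θ s y) ^ 4) t x = 0
  mean_v : tInt (v 0) = 1

/-- `(M, ε)`-bounded initial data: `‖(v₀, u₀, θ₀)‖_{H²} ≤ M` and `v₀ ≥ ε`, `θ₀ ≥ ε`. -/
def DataBounded (M ε : ℝ) (v₀ u₀ θ₀ : ℝ → ℝ) : Prop :=
  Real.sqrt (H2sq v₀ + H2sq u₀ + H2sq θ₀) ≤ M ∧ (∀ x, ε ≤ v₀ x) ∧ ∀ x, ε ≤ θ₀ x

variable {μ R a b κ₁ κ₂ β γ T : ℝ}

/-- A solution has `(M, ε)`-bounded initial data. -/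
def Sol.Bounded (S : Sol μ R a b κ₁ κ₂ β γ T) (M ε : ℝ) : Prop :=
  DataBounded M ε (S.v 0) (S.u 0) (S.θ 0)

/-- The auxiliary function `𝔛(t) = ∫₀ᵗ ∫_𝕋 κ(v,θ) θ_t² / v dx ds`. -/
def Sol.X (S : Sol μ R a b κ₁ κ₂ β γ T) (t : ℝ) : ℝ :=
  ∫ s in (0 : ℝ)..t, tInt fun x =>
    kappa κ₁ κ₂ β (S.v s x) (S.θ s x) * (pt S.θ s x) ^ 2 / S.v s x

/-- The auxiliary function `𝔜(t) = max_{0 ≤ s ≤ t} ∫_𝕋 κ(v,θ)² θ_x² / v² dx`. -/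
def Sol.Y (S : Sol μ R a b κ₁ κ₂ β γ T) (t : ℝ) : ℝ :=
  sSup ((fun s => tInt fun x =>
    (kappa κ₁ κ₂ β (S.v s x) (S.θ s x)) ^ 2 * (px S.θ s x) ^ 2 / (S.v s x) ^ 2) ''
      Icc (0 : ℝ) t)

/-- The auxiliary function `ℨ(t) = max_{0 ≤ s ≤ t} ∫_𝕋 u_{xx}² / v² dx`. -/
def Sol.Z (S : Sol μ R a b κ₁ κ₂ β γ T) (t : ℝ) : ℝ :=
  sSup ((fun s => tInt fun x => (px (px S.u) s x) ^ 2 / (S.v s x) ^ 2) '' Icc (0 : ℝ) t)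

/-- The exponent `𝔗₀(n, p, β)`. -/
def T0 (n _p β : ℝ) : ℝ :=
  if n < (β + 3) / 2 then 4 / (n * (2 * β + 3)) else (n - β + 5) / (n * (2 * β + 3))

/-- The exponent `𝔗₁(n, β)`. -/
def T1 (n β : ℝ) : ℝ := max (T0 n 8 β) (1 / (2 * β + 3) + T0 n 1 β)

/-- The exponent `𝔘ʸ₁₁(n, β)`. -/
def Uy11 (n β : ℝ) : ℝ := 2 / (2 * β + 3) + T0 n 1 β

/-- The exponent `𝔘ᶻ₁₁(n, β)`. -/
def Uz11 (n β : ℝ) : ℝ := 3 / 4 * (1 / (1 - T0 n (5/2) β))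

/-- The exponent `𝔘ʸ₂(n, β)`. -/
def Uy2 (n β : ℝ) : ℝ := 2 / (2 * β + 3) + T1 n β

/-- The exponent `𝔘ᶻ₂(n, β)`. -/
def Uz2 (n β : ℝ) : ℝ := 3 / 4 * (1 / (1 - T0 n (3/2) β - T1 n β))

end RadHydro

open RadHydro

namespace RadHydro

/-- Joint smoothness of a function of time and space. -/
def JointSmooth (F : ℝ → ℝ → ℝ) : Prop := ContDiff ℝ (⊤ : ℕ∞) fun p : ℝ × ℝ => F p.1 p.2

theorem integral_swap {F : ℝ → ℝ → ℝ} (hF : Continuous fun p : ℝ × ℝ => F p.1 p.2)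
    (a b c d : ℝ) :
    ∫ x in a..b, ∫ s in c..d, F s x = ∫ s in c..d, ∫ x in a..b, F s x := by
  have hc : Continuous fun p : ℝ × ℝ => F p.2 p.1 := hF.comp continuous_swap
  apply MeasureTheory.intervalIntegral_intervalIntegral_swap (F := fun x s => F s x)
  exact (hc.continuousOn.integrableOn_compact (isCompact_uIcc.prod isCompact_uIcc)).mono_set
    (prod_mono uIoc_subset_uIcc uIoc_subset_uIcc)

namespace JointSmooth

variable {F G : ℝ → ℝ → ℝ}

theorem hasDerivAt_time (hF : JointSmooth F) (t x : ℝ) :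
    HasDerivAt (fun s => F s x) (pt F t x) t := by
  have h : ContDiff ℝ (⊤ : ℕ∞) (fun s => F s x) :=
    ContDiff.comp (g := fun p : ℝ × ℝ => F p.1 p.2) hF (contDiff_id.prodMk contDiff_const)
  exact ((h.differentiable (by simp)) t).hasDerivAt

theorem hasDerivAt_space (hF : JointSmooth F) (t x : ℝ) : HasDerivAt (F t) (px F t x) x := by
  have h : ContDiff ℝ (⊤ : ℕ∞) (F t) :=
    ContDiff.comp (g := fun p : ℝ × ℝ => F p.1 p.2) hF (contDiff_const.prodMk contDiff_id)
  exact ((h.differentiable (by simp)) x).hasDerivAt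

theorem px (hF : JointSmooth F) : JointSmooth (px F) := by
  have h : ContDiff ℝ (⊤ : ℕ∞) (fun p : ℝ × ℝ => fderiv ℝ (fun p : ℝ × ℝ => F p.1 p.2) p (0, 1)) :=
    (hF.fderiv_right (m := (⊤ : ℕ∞)) (by simp)).clm_apply contDiff_const
  have e : (fun p : ℝ × ℝ => RadHydro.px F p.1 p.2)
      = fun p : ℝ × ℝ => fderiv ℝ (fun p : ℝ × ℝ => F p.1 p.2) p (0, 1) := by
    funext p
    have h1 := ((hF.differentiable (by simp)) p).hasFDerivAt
    have h2 : HasDerivAt (fun y : ℝ => (p.1, y)) ((0 : ℝ), (1 : ℝ)) p.2 :=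
      (hasDerivAt_const p.2 p.1).prodMk (hasDerivAt_id p.2)
    exact (h1.comp_hasDerivAt p.2 h2).deriv
  unfold JointSmooth
  rw [e]
  exact h

theorem pt (hF : JointSmooth F) : JointSmooth (pt F) := by
  have h : ContDiff ℝ (⊤ : ℕ∞) (fun p : ℝ × ℝ => fderiv ℝ (fun p : ℝ × ℝ => F p.1 p.2) p (1, 0)) :=
    (hF.fderiv_right (m := (⊤ : ℕ∞)) (by simp)).clm_apply contDiff_const
  have e : (fun p : ℝ × ℝ => RadHydro.pt F p.1 p.2)
      = fun p : ℝ × ℝ => fderiv ℝ (fun p : ℝ × ℝ => F p.1 p.2) p (1, 0) := by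
    funext p
    have h1 := ((hF.differentiable (by simp)) p).hasFDerivAt
    have h2 : HasDerivAt (fun y : ℝ => (y, p.2)) ((1 : ℝ), (0 : ℝ)) p.1 :=
      (hasDerivAt_id p.1).prodMk (hasDerivAt_const p.1 p.2)
    exact (h1.comp_hasDerivAt p.1 h2).deriv
  unfold JointSmooth
  rw [e]
  exact h

theorem add (hF : JointSmooth F) (hG : JointSmooth G) :
    JointSmooth fun t x => F t x + G t x := ContDiff.add hF hG

theorem sub (hF : JointSmooth F) (hG : JointSmooth G) :
    JointSmooth fun t x => F t x - G t x := ContDiff.sub hF hG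

theorem mul (hF : JointSmooth F) (hG : JointSmooth G) :
    JointSmooth fun t x => F t x * G t x := ContDiff.mul hF hG

theorem div (hF : JointSmooth F) (hG : JointSmooth G) (h : ∀ t x, 0 < G t x) :
    JointSmooth fun t x => F t x / G t x := ContDiff.div hF hG fun p => (h p.1 p.2).ne'

theorem pow (hF : JointSmooth F) (n : ℕ) : JointSmooth fun t x => F t x ^ n := ContDiff.pow hF n

theorem rpow (hF : JointSmooth F) (h : ∀ t x, 0 < F t x) (r : ℝ) :
    JointSmooth fun t x => F t x ^ r := ContDiff.rpow_const_of_ne hF fun p => (h p.1 p.2).ne'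

theorem const (c : ℝ) : JointSmooth fun _ _ => c := contDiff_const

theorem continuous (hF : JointSmooth F) : Continuous fun p : ℝ × ℝ => F p.1 p.2 :=
  ContDiff.continuous hF

theorem continuous_space (hF : JointSmooth F) (t : ℝ) : Continuous (F t) :=
  hF.continuous.comp (Continuous.prodMk_right t)

theorem continuous_time (hF : JointSmooth F) (x : ℝ) : Continuous fun t => F t x :=
  hF.continuous.comp (Continuous.prodMk_left x)

theorem continuous_tInt (hF : JointSmooth F) : Continuous fun t => tInt (F t) :=
  intervalIntegral.continuous_parametric_intervalIntegral_of_continuous' hF.continuous _ _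

theorem integral_pt (hF : JointSmooth F) (t x : ℝ) :
    ∫ s in (0 : ℝ)..t, RadHydro.pt F s x = F t x - F 0 x :=
  intervalIntegral.integral_eq_sub_of_hasDerivAt (fun s _ => hF.hasDerivAt_time s x)
    ((hF.pt.continuous_time x).intervalIntegrable _ _)

theorem integral_px (hF : JointSmooth F) (t x y : ℝ) :
    ∫ z in y..x, RadHydro.px F t z = F t x - F t y :=
  intervalIntegral.integral_eq_sub_of_hasDerivAt (fun s _ => hF.hasDerivAt_space t s)
    ((hF.px.continuous_space t).intervalIntegrable _ _)

theorem integral_tInt_pt (hF : JointSmooth F) (t : ℝ) :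
    ∫ s in (0 : ℝ)..t, tInt (RadHydro.pt F s) = tInt (F t) - tInt (F 0) := by
  unfold tInt
  rw [← integral_swap hF.pt.continuous, ← intervalIntegral.integral_sub
    ((hF.continuous_space t).intervalIntegrable _ _)
    ((hF.continuous_space 0).intervalIntegrable _ _)]
  simp only [hF.integral_pt]

theorem tInt_px_eq_zero (hF : JointSmooth F) {t : ℝ} (hp : Function.Periodic (F t) 1) :
    tInt (RadHydro.px F t) = 0 := by
  unfold tInt
  have h := hp (-(1 / 2))
  rw [hF.integral_px, ← h]
  norm_num

end JointSmooth

theorem periodic_px {F : ℝ → ℝ → ℝ} {t : ℝ} (hp : Function.Periodic (F t) 1) :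
    Function.Periodic (px F t) 1 := by
  intro x
  unfold px
  rw [← deriv_comp_add_const]
  congr 1
  funext y
  exact hp y

section tInt

variable {f g : ℝ → ℝ}

theorem tInt_mono (hf : Continuous f) (hg : Continuous g)
    (h : ∀ x ∈ Icc (-(1 / 2) : ℝ) (1 / 2), f x ≤ g x) : tInt f ≤ tInt g :=
  intervalIntegral.integral_mono_on (by norm_num) (hf.intervalIntegrable _ _)
    (hg.intervalIntegrable _ _) h

theorem tInt_add (hf : Continuous f) (hg : Continuous g) :
    tInt (fun x => f x + g x) = tInt f + tInt g :=
  intervalIntegral.integral_add (hf.intervalIntegrable _ _) (hg.intervalIntegrable _ _)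

theorem tInt_const_mul (c : ℝ) (f : ℝ → ℝ) : tInt (fun x => c * f x) = c * tInt f :=
  intervalIntegral.integral_const_mul c f

theorem tInt_const (c : ℝ) : tInt (fun _ => c) = c := by
  unfold tInt
  rw [intervalIntegral.integral_const]
  norm_num

theorem tInt_nonneg (h : ∀ x, 0 ≤ f x) : 0 ≤ tInt f :=
  intervalIntegral.integral_nonneg (by norm_num) fun x _ => h x

theorem L2sq_nonneg (f : ℝ → ℝ) : 0 ≤ L2sq f := tInt_nonneg fun x => sq_nonneg (f x)

theorem abs_integral_le_tInt (hf : Continuous f) {x y : ℝ}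
    (hx : x ∈ Icc (-(1 / 2) : ℝ) (1 / 2)) (hy : y ∈ Icc (-(1 / 2) : ℝ) (1 / 2)) :
    |∫ z in y..x, f z| ≤ tInt fun z => |f z| := by
  have h1 : |∫ z in y..x, f z| ≤ abs (∫ z in y..x, abs (f z)) := by
    simpa only [Real.norm_eq_abs] using
      intervalIntegral.norm_integral_le_abs_integral_norm (f := f) (μ := volume) (a := y) (b := x)
  have h2 : abs (∫ z in y..x, abs (f z)) ≤ abs (∫ z in (-(1 / 2) : ℝ)..(1 / 2), abs (f z)) := by
    apply intervalIntegral.abs_integral_mono_interval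
    · rw [uIoc_of_le (by norm_num : (-(1 / 2) : ℝ) ≤ 1 / 2)]
      intro z hz
      rw [mem_uIoc] at hz
      constructor <;> rcases hz with hz | hz <;> linarith [hx.1, hx.2, hy.1, hy.2]
    · exact Filter.Eventually.of_forall fun z => abs_nonneg (f z)
    · exact hf.abs.intervalIntegrable _ _
  have h3 : 0 ≤ tInt fun z => |f z| := tInt_nonneg fun z => abs_nonneg (f z)
  exact h1.trans (h2.trans (le_of_eq (abs_of_nonneg h3)))

end tInt

/-- Integral form of Grönwall's inequality with constant coefficients. -/
theorem le_mul_exp_of_le_integral {g : ℝ → ℝ} (hg : Continuous g) {A K T : ℝ} (hK : 0 ≤ K)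
    (h : ∀ t ∈ Icc 0 T, g t ≤ A + K * ∫ s in (0 : ℝ)..t, g s) {t : ℝ} (ht : t ∈ Icc 0 T) :
    g t ≤ A * exp (K * t) := by
  have hd : ∀ s, HasDerivAt (fun s => (A + K * ∫ r in (0 : ℝ)..s, g r) * exp (-(K * s)))
      (K * g s * exp (-(K * s))
        + (A + K * ∫ r in (0 : ℝ)..s, g r) * (exp (-(K * s)) * -(K * 1))) s := by
    intro s
    have h1 : HasDerivAt (fun s => ∫ r in (0 : ℝ)..s, g r) (g s) s :=
      intervalIntegral.integral_hasDerivAt_right (hg.intervalIntegrable _ _)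
        hg.aestronglyMeasurable.stronglyMeasurableAtFilter hg.continuousAt
    exact ((h1.const_mul K).const_add A).mul (((hasDerivAt_id s).const_mul K).neg.exp)
  have hanti : AntitoneOn (fun s => (A + K * ∫ r in (0 : ℝ)..s, g r) * exp (-(K * s)))
      (Icc 0 T) := by
    apply antitoneOn_of_deriv_nonpos (convex_Icc 0 T)
    · exact fun s _ => (hd s).continuousAt.continuousWithinAt
    · exact fun s _ => (hd s).differentiableAt.differentiableWithinAt
    · intro s hs
      rw [interior_Icc] at hs
      rw [(hd s).deriv]
      have h1 := h s ⟨hs.1.le, hs.2.le⟩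
      have h2 := mul_nonneg (mul_nonneg hK (exp_pos (-(K * s))).le) (sub_nonneg.2 h1)
      linarith
  have h1 := hanti (left_mem_Icc.2 (ht.1.trans ht.2)) ht ht.1
  simp only [intervalIntegral.integral_same, mul_zero, add_zero, neg_zero, exp_zero, mul_one] at h1
  calc g t ≤ A + K * ∫ s in (0 : ℝ)..t, g s := h t ht
    _ = ((A + K * ∫ r in (0 : ℝ)..t, g r) * exp (-(K * t))) * exp (K * t) := by
      rw [mul_assoc, ← exp_add]; simp
    _ ≤ A * exp (K * t) := by gcongr

namespace Sol

variable {μ R a b κ₁ κ₂ β γ T : ℝ} (S : Sol μ R a b κ₁ κ₂ β γ T)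

/-- The pressure `Rθ/v`. -/
def press (t x : ℝ) : ℝ := R * S.θ t x / S.v t x

/-- The viscous stress `μu_x/v`. -/
def visc (t x : ℝ) : ℝ := μ * px S.u t x / S.v t x

/-- The conductive heat flux `κθ_x/v`. -/
def heat (t x : ℝ) : ℝ := kappa κ₁ κ₂ β (S.v t x) (S.θ t x) * px S.θ t x / S.v t x

/-- The quotient `q_x/v`. -/
def rad (t x : ℝ) : ℝ := px S.q t x / S.v t x

theorem jointSmooth_v : JointSmooth S.v := S.smooth_v

theorem jointSmooth_u : JointSmooth S.u := S.smooth_u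

theorem jointSmooth_θ : JointSmooth S.θ := S.smooth_θ

theorem jointSmooth_q : JointSmooth S.q := S.smooth_q

theorem jointSmooth_kappa : JointSmooth fun t x => kappa κ₁ κ₂ β (S.v t x) (S.θ t x) :=
  (JointSmooth.const κ₁).add
    (((JointSmooth.const κ₂).mul S.jointSmooth_v).mul (S.jointSmooth_θ.rpow S.θ_pos β))

theorem jointSmooth_press : JointSmooth S.press :=
  ((JointSmooth.const R).mul S.jointSmooth_θ).div S.jointSmooth_v S.v_pos

theorem jointSmooth_visc : JointSmooth S.visc :=
  ((JointSmooth.const μ).mul S.jointSmooth_u.px).div S.jointSmooth_v S.v_pos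

theorem jointSmooth_heat : JointSmooth S.heat :=
  (S.jointSmooth_kappa.mul S.jointSmooth_θ.px).div S.jointSmooth_v S.v_pos

theorem jointSmooth_rad : JointSmooth S.rad := S.jointSmooth_q.px.div S.jointSmooth_v S.v_pos

theorem periodic_press (t : ℝ) : Function.Periodic (S.press t) 1 := by
  intro x
  simp only [press, S.periodic_v t x, S.periodic_θ t x]

theorem periodic_visc (t : ℝ) : Function.Periodic (S.visc t) 1 := by
  intro x
  simp only [visc, S.periodic_v t x, periodic_px (S.periodic_u t) x]

theorem periodic_heat (t : ℝ) : Function.Periodic (S.heat t) 1 := by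
  intro x
  simp only [heat, S.periodic_v t x, S.periodic_θ t x, periodic_px (S.periodic_θ t) x]

theorem periodic_rad (t : ℝ) : Function.Periodic (S.rad t) 1 := by
  intro x
  simp only [rad, S.periodic_v t x, periodic_px (S.periodic_q t) x]

theorem pt_u_eq {t : ℝ} (ht : t ∈ Icc 0 T) (x : ℝ) :
    pt S.u t x = px S.visc t x - px S.press t x :=
  eq_sub_of_add_eq (S.eq_mom t ht x)

theorem pt_energy_eq {t : ℝ} (ht : t ∈ Icc 0 T) (x : ℝ) :
    pt (fun s y => R / (γ - 1) * S.θ s y + S.u s y ^ 2 / 2) t x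
      = px (fun s y => S.u s y * S.visc s y + S.heat s y - S.press s y * S.u s y - S.q s y) t x := by
  have h := S.eq_energy t ht x
  have hu := S.jointSmooth_u.hasDerivAt_space t x
  have hp := S.jointSmooth_press.hasDerivAt_space t x
  have hs := S.jointSmooth_visc.hasDerivAt_space t x
  have hh := S.jointSmooth_heat.hasDerivAt_space t x
  have hq := S.jointSmooth_q.hasDerivAt_space t x
  have e1 : px (fun s y => R * S.θ s y / S.v s y * S.u s y) t x
      = px S.press t x * S.u t x + S.press t x * px S.u t x := (hp.mul hu).deriv
  have e2 : px (fun s y => μ * S.u s y * px S.u s y / S.v s y) t x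
      = px S.u t x * S.visc t x + S.u t x * px S.visc t x := by
    rw [← (hu.mul hs).deriv, px]
    congr 1
    funext y
    simp only [Pi.mul_apply, visc]
    ring
  have e3 : px (fun s y => S.u s y * S.visc s y + S.heat s y - S.press s y * S.u s y - S.q s y) t x
      = px S.u t x * S.visc t x + S.u t x * px S.visc t x + px S.heat t x
        - (px S.press t x * S.u t x + S.press t x * px S.u t x) - px S.q t x :=
    ((((hu.mul hs).add hh).sub (hp.mul hu)).sub hq).deriv
  have e4 : px (fun s y => kappa κ₁ κ₂ β (S.v s y) (S.θ s y) * px S.θ s y / S.v s y) t x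
      = px S.heat t x := rfl
  rw [e1, e2, e4] at h
  rw [e3]
  linarith

/-- The balance of internal energy. -/
theorem pt_θ_eq {t : ℝ} (ht : t ∈ Icc 0 T) (x : ℝ) :
    R / (γ - 1) * pt S.θ t x
      = px S.u t x * (S.visc t x - S.press t x) + px S.heat t x - px S.q t x := by
  have h := S.pt_energy_eq ht x
  have hu := S.jointSmooth_u.hasDerivAt_space t x
  have hp := S.jointSmooth_press.hasDerivAt_space t x
  have hs := S.jointSmooth_visc.hasDerivAt_space t x
  have hh := S.jointSmooth_heat.hasDerivAt_space t x
  have hq := S.jointSmooth_q.hasDerivAt_space t x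
  have e3 : px (fun s y => S.u s y * S.visc s y + S.heat s y - S.press s y * S.u s y - S.q s y) t x
      = px S.u t x * S.visc t x + S.u t x * px S.visc t x + px S.heat t x
        - (px S.press t x * S.u t x + S.press t x * px S.u t x) - px S.q t x :=
    ((((hu.mul hs).add hh).sub (hp.mul hu)).sub hq).deriv
  have e4 : pt (fun s y => R / (γ - 1) * S.θ s y + S.u s y ^ 2 / 2) t x
      = R / (γ - 1) * pt S.θ t x + (2 : ℕ) * S.u t x ^ (2 - 1) * pt S.u t x / 2 :=
    (((S.jointSmooth_θ.hasDerivAt_time t x).const_mul (R / (γ - 1))).add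
      (((S.jointSmooth_u.hasDerivAt_time t x).pow 2).div_const 2)).deriv
  rw [e3, e4, S.pt_u_eq ht x] at h
  norm_num at h
  linear_combination h

theorem tInt_v {t : ℝ} (ht : t ∈ Icc 0 T) : tInt (S.v t) = 1 := by
  have h := S.jointSmooth_v.integral_tInt_pt t
  have h0 : ∀ s ∈ uIcc 0 t, tInt (pt S.v s) = 0 := by
    intro s hs
    rw [uIcc_of_le ht.1] at hs
    rw [← S.jointSmooth_u.tInt_px_eq_zero (S.periodic_u s)]
    congr 1
    funext x
    exact sub_eq_zero.1 (S.eq_mass s ⟨hs.1, hs.2.trans ht.2⟩ x)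
  rw [intervalIntegral.integral_congr (g := fun _ => (0 : ℝ)) h0,
    intervalIntegral.integral_zero, S.mean_v] at h
  linarith

theorem tInt_energy {t : ℝ} (ht : t ∈ Icc 0 T) :
    R / (γ - 1) * tInt (S.θ t) + L2sq (S.u t) / 2
      = R / (γ - 1) * tInt (S.θ 0) + L2sq (S.u 0) / 2 := by
  have hF : JointSmooth fun s y => R / (γ - 1) * S.θ s y + S.u s y ^ 2 / 2 :=
    ((JointSmooth.const _).mul S.jointSmooth_θ).add
      ((S.jointSmooth_u.pow 2).div (JointSmooth.const 2) (by norm_num))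
  have hG : JointSmooth fun s y =>
      S.u s y * S.visc s y + S.heat s y - S.press s y * S.u s y - S.q s y :=
    (((S.jointSmooth_u.mul S.jointSmooth_visc).add S.jointSmooth_heat).sub
      (S.jointSmooth_press.mul S.jointSmooth_u)).sub S.jointSmooth_q
  have h := hF.integral_tInt_pt t
  have h0 : ∀ s ∈ uIcc 0 t,
      tInt (pt (fun s y => R / (γ - 1) * S.θ s y + S.u s y ^ 2 / 2) s) = 0 := by
    intro s hs
    rw [uIcc_of_le ht.1] at hs
    rw [← hG.tInt_px_eq_zero (t := s) ?_]
    · congr 1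
      funext x
      exact S.pt_energy_eq ⟨hs.1, hs.2.trans ht.2⟩ x
    · intro x
      simp only [S.periodic_u s x, S.periodic_visc s x, S.periodic_heat s x, S.periodic_press s x,
        S.periodic_q s x]
  have e : ∀ s, tInt (fun y => R / (γ - 1) * S.θ s y + S.u s y ^ 2 / 2)
      = R / (γ - 1) * tInt (S.θ s) + L2sq (S.u s) / 2 := by
    intro s
    have hθ := S.jointSmooth_θ.continuous_space s
    have hu := S.jointSmooth_u.continuous_space s
    rw [tInt_add (by fun_prop) (by fun_prop), tInt_const_mul]
    congr 1
    unfold L2sq tInt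
    rw [intervalIntegral.integral_div]
  rw [intervalIntegral.integral_congr (g := fun _ => (0 : ℝ)) h0,
    intervalIntegral.integral_zero, e, e] at h
  linarith

theorem tInt_θ_nonneg (t : ℝ) : 0 ≤ tInt (S.θ t) := tInt_nonneg fun x => (S.θ_pos t x).le

variable {S}

theorem Bounded.L2sq_le {M ε : ℝ} (hS : S.Bounded M ε) (hM : 0 ≤ M) :
    L2sq (S.u 0) ≤ M ^ 2 ∧ L2sq (S.θ 0) ≤ M ^ 2 := by
  have h := (Real.sqrt_le_left hM).1 hS.1
  simp only [H2sq] at h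
  have := L2sq_nonneg
  constructor <;>
  linarith [this (S.v 0), this (deriv (S.v 0)), this (deriv (deriv (S.v 0))), this (S.u 0),
    this (deriv (S.u 0)), this (deriv (deriv (S.u 0))), this (S.θ 0), this (deriv (S.θ 0)),
    this (deriv (deriv (S.θ 0)))]

theorem exists_energy_bound (hR : 0 < R) (hγ : 1 < γ) (M ε : ℝ) (hM : 1 ≤ M) :
    ∃ E : ℝ, 0 < E ∧ ∀ S : Sol μ R a b κ₁ κ₂ β γ T, S.Bounded M ε → ∀ t ∈ Icc 0 T,
      tInt (S.θ t) ≤ E ∧ L2sq (S.u t) ≤ E := by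
  have hc : 0 < R / (γ - 1) := div_pos hR (by linarith)
  set k := R / (γ - 1) with hk
  have hM2 : 0 < M ^ 2 := by positivity
  refine ⟨(k * (1 + M ^ 2) + M ^ 2) / k + 2 * (k * (1 + M ^ 2) + M ^ 2), by positivity, ?_⟩
  intro S hS t ht
  obtain ⟨hu, hθ⟩ := hS.L2sq_le (by linarith)
  have h1 : tInt (S.θ 0) ≤ 1 + M ^ 2 := by
    have hc := S.jointSmooth_θ.continuous_space 0
    calc tInt (S.θ 0) ≤ tInt fun x => 1 + S.θ 0 x ^ 2 :=
          tInt_mono hc (by fun_prop) fun x _ => by nlinarith [sq_nonneg (S.θ 0 x - 1 / 2)]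
      _ = 1 + L2sq (S.θ 0) := by
          rw [tInt_add (by fun_prop) (by fun_prop), tInt_const]; rfl
      _ ≤ 1 + M ^ 2 := by linarith
  have h2 := S.tInt_energy ht
  rw [← hk] at h2
  have h3 : k * tInt (S.θ 0) ≤ k * (1 + M ^ 2) := mul_le_mul_of_nonneg_left h1 hc.le
  have h4 := mul_nonneg hc.le (S.tInt_θ_nonneg t)
  have h5 := L2sq_nonneg (S.u t)
  have h6 : 0 < k * (1 + M ^ 2) + M ^ 2 := by positivity
  have h7 : 0 < (k * (1 + M ^ 2) + M ^ 2) / k := by positivity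
  constructor
  · have : tInt (S.θ t) ≤ (k * (1 + M ^ 2) + M ^ 2) / k := by
      rw [le_div_iff₀ hc]; linarith
    linarith
  · linarith

end Sol

namespace Sol

variable {μ R a b κ₁ κ₂ β γ T : ℝ} (S : Sol μ R a b κ₁ κ₂ β γ T)

/-- The time integral of the total stress at the space point `x`. -/
def impulse (t x : ℝ) : ℝ := ∫ s in (0 : ℝ)..t, (S.visc s x - S.press s x)

theorem continuous_impulse (x : ℝ) : Continuous fun t => S.impulse t x := by
  have hs := S.jointSmooth_visc.continuous_time x
  have hp := S.jointSmooth_press.continuous_time x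
  exact intervalIntegral.continuous_primitive
    (fun c d => (hs.sub hp).intervalIntegrable c d) 0

theorem impulse_sub_impulse {t : ℝ} (ht : t ∈ Icc 0 T) (x : ℝ) :
    S.impulse t x - S.impulse t 0 = ∫ z in (0 : ℝ)..x, (S.u t z - S.u 0 z) := by
  have hσ := S.jointSmooth_visc.sub S.jointSmooth_press
  simp only [← S.jointSmooth_u.integral_pt]
  rw [integral_swap S.jointSmooth_u.pt.continuous, impulse, impulse,
    ← intervalIntegral.integral_sub ((hσ.continuous_time x).intervalIntegrable _ _)
      ((hσ.continuous_time 0).intervalIntegrable _ _)]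
  refine intervalIntegral.integral_congr fun s hs => ?_
  rw [uIcc_of_le ht.1] at hs
  have e : ∀ z, pt S.u s z = px (fun s y => S.visc s y - S.press s y) s z := fun z => by
    rw [S.pt_u_eq ⟨hs.1, hs.2.trans ht.2⟩]
    exact ((S.jointSmooth_visc.hasDerivAt_space s z).sub
      (S.jointSmooth_press.hasDerivAt_space s z)).deriv.symm
  simp only [e, hσ.integral_px]

theorem abs_impulse_sub_impulse_le {t : ℝ} (ht : t ∈ Icc 0 T) {x : ℝ}
    (hx : x ∈ Icc (-(1 / 2) : ℝ) (1 / 2)) :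
    |S.impulse t x - S.impulse t 0| ≤ 1 + L2sq (S.u t) + L2sq (S.u 0) := by
  have h1 := S.jointSmooth_u.continuous_space t
  have h0 := S.jointSmooth_u.continuous_space 0
  rw [S.impulse_sub_impulse ht]
  calc abs (∫ z in (0 : ℝ)..x, (S.u t z - S.u 0 z))
      ≤ tInt fun z => |S.u t z - S.u 0 z| :=
        abs_integral_le_tInt (h1.sub h0) hx (by norm_num)
    _ ≤ tInt fun z => 1 + S.u t z ^ 2 + S.u 0 z ^ 2 := by
        refine tInt_mono (by fun_prop) (by fun_prop) fun z _ => abs_le.2 ⟨?_, ?_⟩ <;>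
        nlinarith [sq_nonneg (S.u t z - 1 / 2), sq_nonneg (S.u t z + 1 / 2),
          sq_nonneg (S.u 0 z - 1 / 2), sq_nonneg (S.u 0 z + 1 / 2)]
    _ = 1 + L2sq (S.u t) + L2sq (S.u 0) := by
        rw [tInt_add (by fun_prop) (by fun_prop), tInt_add (by fun_prop) (by fun_prop), tInt_const]
        rfl

/-- Kazhikhov's representation of the specific volume. -/
theorem v_eq (hμ : 0 < μ) {t : ℝ} (ht : t ∈ Icc 0 T) (x : ℝ) :
    S.v t x = S.v 0 x * exp (S.impulse t x / μ) * exp ((∫ s in (0 : ℝ)..t, S.press s x) / μ) := by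
  have hs := S.jointSmooth_visc.continuous_time x
  have hp := S.jointSmooth_press.continuous_time x
  have h : ∫ s in (0 : ℝ)..t, S.visc s x = μ * log (S.v t x) - μ * log (S.v 0 x) := by
    refine intervalIntegral.integral_eq_sub_of_hasDerivAt
      (f := fun s => μ * log (S.v s x)) (fun s hs => ?_) (hs.intervalIntegrable _ _)
    rw [uIcc_of_le ht.1] at hs
    have h1 := ((S.jointSmooth_v.hasDerivAt_time s x).log (S.v_pos s x).ne').const_mul μ
    rw [sub_eq_zero.1 (S.eq_mass s ⟨hs.1, hs.2.trans ht.2⟩ x), ← mul_div_assoc] at h1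
    exact h1
  have h2 : S.impulse t x = (∫ s in (0 : ℝ)..t, S.visc s x) - ∫ s in (0 : ℝ)..t, S.press s x :=
    intervalIntegral.integral_sub (hs.intervalIntegrable _ _) (hp.intervalIntegrable _ _)
  have h3 : log (S.v t x)
      = log (S.v 0 x) + S.impulse t x / μ + (∫ s in (0 : ℝ)..t, S.press s x) / μ := by
    rw [h2, h]
    field_simp
    ring
  rw [← exp_log (S.v_pos t x), h3, exp_add, exp_add, exp_log (S.v_pos 0 x)]

theorem press_nonneg (hR : 0 < R) (t x : ℝ) : 0 ≤ S.press t x :=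
  div_nonneg (mul_nonneg hR.le (S.θ_pos t x).le) (S.v_pos t x).le

/-- The pressure factor in Kazhikhov's representation, weighted by the initial volume. -/
theorem v_zero_mul_exp_le (hμ : 0 < μ) (hR : 0 < R) {N : ℝ} {x : ℝ}
    (hN : ∀ s ∈ Icc 0 T, |S.impulse s x - S.impulse s 0| ≤ N) {t : ℝ} (ht : t ∈ Icc 0 T) :
    S.v 0 x * exp ((∫ s in (0 : ℝ)..t, S.press s x) / μ)
      ≤ S.v 0 x + R / μ * exp (N / μ)
        * ∫ s in (0 : ℝ)..t, S.θ s x * exp (-(S.impulse s 0 / μ)) := by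
  have hp := S.jointSmooth_press.continuous_time x
  have hθ := S.jointSmooth_θ.continuous_time x
  have hI := S.continuous_impulse 0
  have hprim : Continuous fun s => ∫ r in (0 : ℝ)..s, S.press r x :=
    intervalIntegral.continuous_primitive (fun c d => hp.intervalIntegrable c d) 0
  have hd : ∀ s ∈ uIcc 0 t, HasDerivAt
      (fun s => S.v 0 x * exp ((∫ r in (0 : ℝ)..s, S.press r x) / μ))
      (S.v 0 x * (exp ((∫ r in (0 : ℝ)..s, S.press r x) / μ) * (S.press s x / μ))) s := by
    intro s _
    have h1 : HasDerivAt (fun s => ∫ r in (0 : ℝ)..s, S.press r x) (S.press s x) s :=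
      intervalIntegral.integral_hasDerivAt_right (hp.intervalIntegrable _ _)
        hp.aestronglyMeasurable.stronglyMeasurableAtFilter hp.continuousAt
    exact ((h1.div_const μ).exp).const_mul _
  have hc : Continuous fun s =>
      S.v 0 x * (exp ((∫ r in (0 : ℝ)..s, S.press r x) / μ) * (S.press s x / μ)) := by
    fun_prop
  have h := intervalIntegral.integral_eq_sub_of_hasDerivAt hd (hc.intervalIntegrable _ _)
  simp only [intervalIntegral.integral_same, zero_div, exp_zero, mul_one] at h
  have hle : ∫ s in (0 : ℝ)..t,
        S.v 0 x * (exp ((∫ r in (0 : ℝ)..s, S.press r x) / μ) * (S.press s x / μ))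
      ≤ ∫ s in (0 : ℝ)..t, R / μ * exp (N / μ) * (S.θ s x * exp (-(S.impulse s 0 / μ))) := by
    refine intervalIntegral.integral_mono_on ht.1 (hc.intervalIntegrable _ _)
      (Continuous.intervalIntegrable (by fun_prop) _ _) fun s hs => ?_
    have hsT : s ∈ Icc 0 T := ⟨hs.1, hs.2.trans ht.2⟩
    have hv := S.v_eq hμ hsT x
    have hv0 := S.v_pos s x
    have e1 : S.v 0 x * (exp ((∫ r in (0 : ℝ)..s, S.press r x) / μ) * (S.press s x / μ))
        = R / μ * S.θ s x * exp (-(S.impulse s x / μ)) := by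
      have e2 : S.v 0 x * exp ((∫ r in (0 : ℝ)..s, S.press r x) / μ)
          = S.v s x * exp (-(S.impulse s x / μ)) := by
        rw [hv, exp_neg]
        field_simp
      rw [← mul_assoc, e2, press]
      field_simp
    have e3 : exp (-(S.impulse s x / μ)) ≤ exp (N / μ) * exp (-(S.impulse s 0 / μ)) := by
      rw [← exp_add, exp_le_exp, ← neg_div, ← neg_div, ← add_div]
      have := (abs_le.1 (hN s hsT)).1
      gcongr
      linarith
    have h0 : 0 ≤ R / μ * S.θ s x := mul_nonneg (div_pos hR hμ).le (S.θ_pos s x).le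
    rw [e1]
    calc R / μ * S.θ s x * exp (-(S.impulse s x / μ))
        ≤ R / μ * S.θ s x * (exp (N / μ) * exp (-(S.impulse s 0 / μ))) :=
          mul_le_mul_of_nonneg_left e3 h0
      _ = R / μ * exp (N / μ) * (S.θ s x * exp (-(S.impulse s 0 / μ))) := by ring
  rw [h, intervalIntegral.integral_const_mul] at hle
  linarith

theorem exp_neg_impulse_le (hμ : 0 < μ) (hR : 0 < R) {N E : ℝ}
    (hN : ∀ s ∈ Icc 0 T, ∀ x ∈ Icc (-(1 / 2) : ℝ) (1 / 2),
      |S.impulse s x - S.impulse s 0| ≤ N)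
    (hE0 : 0 ≤ E) (hE : ∀ s ∈ Icc 0 T, tInt (S.θ s) ≤ E) {t : ℝ} (ht : t ∈ Icc 0 T) :
    exp (-(S.impulse t 0 / μ))
      ≤ exp (N / μ) * exp (exp (N / μ) * (R / μ * exp (N / μ) * E) * t) := by
  have hI := S.continuous_impulse 0
  have hg : Continuous fun t => exp (-(S.impulse t 0 / μ)) := by fun_prop
  refine le_mul_exp_of_le_integral hg (T := T) (by positivity) (fun t ht => ?_) ht
  set k := R / μ * exp (N / μ) with hk
  have hk0 : 0 < k := by positivity
  have hF : Continuous fun p : ℝ × ℝ => S.θ p.1 p.2 * exp (-(S.impulse p.1 0 / μ)) :=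
    S.jointSmooth_θ.continuous.mul (hg.comp continuous_fst)
  have hJ : Continuous fun x => ∫ s in (0 : ℝ)..t, S.θ s x * exp (-(S.impulse s 0 / μ)) :=
    intervalIntegral.continuous_parametric_intervalIntegral_of_continuous'
      (f := fun x s => S.θ s x * exp (-(S.impulse s 0 / μ))) (hF.comp continuous_swap) _ _
  have hv0 := S.jointSmooth_v.continuous_space 0
  have hT0 : (0 : ℝ) ∈ Icc 0 T := ⟨le_rfl, ht.1.trans ht.2⟩
  have h1 : tInt (S.v t) ≤ tInt fun x => exp (N / μ) * exp (S.impulse t 0 / μ)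
      * (S.v 0 x + k * ∫ s in (0 : ℝ)..t, S.θ s x * exp (-(S.impulse s 0 / μ))) := by
    refine tInt_mono (S.jointSmooth_v.continuous_space t) (by fun_prop) fun x hx => ?_
    have h2 := S.v_zero_mul_exp_le hμ hR (fun s hs => hN s hs x hx) ht
    have h3 : exp (S.impulse t x / μ) ≤ exp (N / μ) * exp (S.impulse t 0 / μ) := by
      rw [← exp_add, exp_le_exp, ← add_div]
      have := (abs_le.1 (hN t ht x hx)).2
      gcongr
      linarith
    calc S.v t x = exp (S.impulse t x / μ)
          * (S.v 0 x * exp ((∫ s in (0 : ℝ)..t, S.press s x) / μ)) := by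
          rw [S.v_eq hμ ht x]; ring
      _ ≤ _ := mul_le_mul h3 h2 (mul_pos (S.v_pos 0 x) (exp_pos _)).le (by positivity)
  have h4 : tInt (fun x => ∫ s in (0 : ℝ)..t, S.θ s x * exp (-(S.impulse s 0 / μ)))
      ≤ E * ∫ s in (0 : ℝ)..t, exp (-(S.impulse s 0 / μ)) := by
    unfold tInt
    rw [integral_swap (F := fun s x => S.θ s x * exp (-(S.impulse s 0 / μ))) hF,
      ← intervalIntegral.integral_const_mul]
    simp only [intervalIntegral.integral_mul_const]
    refine intervalIntegral.integral_mono_on ht.1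
      ((S.jointSmooth_θ.continuous_tInt.mul hg).intervalIntegrable _ _)
      ((hg.const_mul E).intervalIntegrable _ _) fun s hs => ?_
    exact mul_le_mul_of_nonneg_right (hE s ⟨hs.1, hs.2.trans ht.2⟩) (exp_pos _).le
  rw [S.tInt_v ht, tInt_const_mul, tInt_add hv0 (by fun_prop), tInt_const_mul, S.mean_v] at h1
  have h5 : 1 ≤ exp (N / μ) * exp (S.impulse t 0 / μ)
      * (1 + k * (E * ∫ s in (0 : ℝ)..t, exp (-(S.impulse s 0 / μ)))) := by
    refine h1.trans ?_
    gcongr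
  have h6 := mul_le_mul_of_nonneg_left h5 (exp_pos (-(S.impulse t 0 / μ))).le
  have h7 : exp (-(S.impulse t 0 / μ)) * exp (S.impulse t 0 / μ) = 1 := by
    rw [← exp_add]; simp
  calc exp (-(S.impulse t 0 / μ)) = exp (-(S.impulse t 0 / μ)) * 1 := (mul_one _).symm
    _ ≤ _ := h6
    _ = (exp (-(S.impulse t 0 / μ)) * exp (S.impulse t 0 / μ)) * (exp (N / μ)
      * (1 + k * (E * ∫ s in (0 : ℝ)..t, exp (-(S.impulse s 0 / μ))))) := by ring
    _ = _ := by rw [h7]; ring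

variable {S}

/-- The specific volume is bounded below by a positive constant. -/
theorem exists_v_lower_bound (hμ : 0 < μ) (hR : 0 < R) (hγ : 1 < γ) (M ε : ℝ) (hM : 1 ≤ M)
    (hε : 0 < ε) :
    ∃ c : ℝ, 0 < c ∧ ∀ S : Sol μ R a b κ₁ κ₂ β γ T, S.Bounded M ε → ∀ t ∈ Icc 0 T,
      ∀ x ∈ Icc (-(1 / 2) : ℝ) (1 / 2), c ≤ S.v t x := by
  obtain ⟨E, hE, hb⟩ := exists_energy_bound (a := a) (b := b) (κ₁ := κ₁) (κ₂ := κ₂) (β := β)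
    (T := T) hR hγ M ε hM
  set N := 1 + E + E with hN
  set g := exp (N / μ) * exp (exp (N / μ) * (R / μ * exp (N / μ) * E) * T) with hg
  refine ⟨ε * (exp (-(N / μ)) * g⁻¹), by positivity, fun S hS t ht x hx => ?_⟩
  have hT0 : (0 : ℝ) ∈ Icc 0 T := ⟨le_rfl, ht.1.trans ht.2⟩
  have hNb : ∀ s ∈ Icc 0 T, ∀ x ∈ Icc (-(1 / 2) : ℝ) (1 / 2),
      |S.impulse s x - S.impulse s 0| ≤ N := fun s hs x hx =>
    (S.abs_impulse_sub_impulse_le hs hx).trans (by linarith [(hb S hS s hs).2, (hb S hS 0 hT0).2])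
  have h1 : exp (-(S.impulse t 0 / μ)) ≤ g := by
    refine (S.exp_neg_impulse_le hμ hR hNb hE.le (fun s hs => (hb S hS s hs).1) ht).trans ?_
    have := ht.2
    rw [hg]
    gcongr
  have h2 : g⁻¹ ≤ exp (S.impulse t 0 / μ) := by
    rw [inv_le_comm₀ (by positivity) (exp_pos _), ← exp_neg]
    exact h1
  have h3 : exp (-(N / μ)) * exp (S.impulse t 0 / μ) ≤ exp (S.impulse t x / μ) := by
    rw [← exp_add, exp_le_exp, ← neg_div, ← add_div]
    have := (abs_le.1 (hNb t ht x hx)).1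
    gcongr
    linarith
  have h4 : 1 ≤ exp ((∫ s in (0 : ℝ)..t, S.press s x) / μ) :=
    one_le_exp (div_nonneg
      (intervalIntegral.integral_nonneg ht.1 fun s _ => S.press_nonneg hR s x) hμ.le)
  have h5 : exp (-(N / μ)) * g⁻¹ ≤ exp (S.impulse t x / μ) :=
    (mul_le_mul_of_nonneg_left h2 (exp_pos _).le).trans h3
  rw [S.v_eq hμ ht x]
  calc ε * (exp (-(N / μ)) * g⁻¹) ≤ S.v 0 x * exp (S.impulse t x / μ) :=
        mul_le_mul (hS.2.1 x) h5 (by positivity) (S.v_pos 0 x).le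
    _ ≤ _ := le_mul_of_one_le_right (mul_pos (S.v_pos 0 x) (exp_pos _)).le h4

end Sol

namespace Sol

variable {μ R a b κ₁ κ₂ β γ T : ℝ} (S : Sol μ R a b κ₁ κ₂ β γ T)

theorem bddAbove_Y (t : ℝ) : BddAbove ((fun s => tInt fun x =>
    (kappa κ₁ κ₂ β (S.v s x) (S.θ s x)) ^ 2 * (px S.θ s x) ^ 2 / (S.v s x) ^ 2) ''
      Icc (0 : ℝ) t) := by
  have h := ((S.jointSmooth_kappa.pow 2).mul (S.jointSmooth_θ.px.pow 2)).div
    (S.jointSmooth_v.pow 2) fun t x => pow_pos (S.v_pos t x) 2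
  exact isCompact_Icc.bddAbove_image h.continuous_tInt.continuousOn

theorem le_Y {s t : ℝ} (hs : s ∈ Icc 0 t) : (tInt fun x =>
    (kappa κ₁ κ₂ β (S.v s x) (S.θ s x)) ^ 2 * (px S.θ s x) ^ 2 / (S.v s x) ^ 2) ≤ S.Y t :=
  le_csSup (S.bddAbove_Y t) (mem_image_of_mem _ hs)

theorem Y_nonneg {t : ℝ} (ht : 0 ≤ t) : 0 ≤ S.Y t :=
  (tInt_nonneg fun x => by positivity).trans (S.le_Y (left_mem_Icc.2 ht))

/-- A pointwise form of the Cauchy–Schwarz step for the derivative of `θ ^ (β + 3/2)`. -/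
theorem abs_rpow_mul_px_le (hκ₁ : 0 < κ₁) (hκ₂ : 0 < κ₂) {l : ℝ} (hl : 0 < l) (t x : ℝ) :
    |S.θ t x ^ (β + 1 / 2) * px S.θ t x| ≤ l * S.θ t x + (κ₂ ^ 2 * l)⁻¹ *
      (kappa κ₁ κ₂ β (S.v t x) (S.θ t x) ^ 2 * px S.θ t x ^ 2 / S.v t x ^ 2) := by
  have hθ := S.θ_pos t x
  have hv := S.v_pos t x
  have hr : 0 < S.θ t x ^ β := rpow_pos_of_pos hθ β
  set r := S.θ t x ^ β
  set p := px S.θ t x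
  have e1 : S.θ t x ^ (β + 1 / 2) = r * √(S.θ t x) := by
    rw [rpow_add hθ, ← sqrt_eq_rpow]
  have hk : κ₂ * r ≤ kappa κ₁ κ₂ β (S.v t x) (S.θ t x) / S.v t x := by
    rw [le_div_iff₀ hv]
    change κ₂ * r * S.v t x ≤ κ₁ + κ₂ * S.v t x * r
    linarith
  have e2 : kappa κ₁ κ₂ β (S.v t x) (S.θ t x) ^ 2 * p ^ 2 / S.v t x ^ 2
      = (kappa κ₁ κ₂ β (S.v t x) (S.θ t x) / S.v t x) ^ 2 * p ^ 2 := by ring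
  have h1 : (κ₂ * r) ^ 2 * p ^ 2 ≤ kappa κ₁ κ₂ β (S.v t x) (S.θ t x) ^ 2 * p ^ 2 / S.v t x ^ 2 := by
    rw [e2]
    gcongr
  have h2 : (κ₂ ^ 2 * l)⁻¹ * ((κ₂ * r) ^ 2 * p ^ 2) = r ^ 2 * p ^ 2 / l := by
    field_simp
  have h3 : r ^ 2 * p ^ 2 / l ≤ (κ₂ ^ 2 * l)⁻¹ *
      (kappa κ₁ κ₂ β (S.v t x) (S.θ t x) ^ 2 * p ^ 2 / S.v t x ^ 2) := by
    rw [← h2]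
    gcongr
  have h4 : |r * √(S.θ t x) * p| ≤ l * S.θ t x + r ^ 2 * p ^ 2 / l := by
    rw [mul_right_comm, abs_mul, abs_of_nonneg (sqrt_nonneg _)]
    have e3 : r ^ 2 * p ^ 2 / l = (|r * p| / √l) ^ 2 := by
      rw [div_pow, sq_sqrt hl.le, sq_abs]
      ring
    have e4 : l * S.θ t x = (√l * √(S.θ t x)) ^ 2 := by
      rw [mul_pow, sq_sqrt hl.le, sq_sqrt hθ.le]
    have e5 : |r * p| * √(S.θ t x) = (|r * p| / √l) * (√l * √(S.θ t x)) := by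
      have := sqrt_pos.2 hl
      field_simp
    rw [e3, e4, e5]
    nlinarith [sq_nonneg (|r * p| / √l - √l * √(S.θ t x)), sq_nonneg (|r * p| / √l),
      sq_nonneg (√l * √(S.θ t x))]
  rw [e1]
  exact h4.trans (by linarith)

theorem θ_rpow_le (hκ₁ : 0 < κ₁) (hκ₂ : 0 < κ₂) (hβ : 0 < β) {E : ℝ} {s t : ℝ}
    (hs : s ∈ Icc 0 t) (hE : tInt (S.θ s) ≤ E) {x : ℝ}
    (hx : x ∈ Icc (-(1 / 2) : ℝ) (1 / 2)) :
    S.θ s x ^ (β + 3 / 2)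
      ≤ ((E + 1) ^ (β + 3 / 2) + (β + 3 / 2) * (E + (κ₂ ^ 2)⁻¹)) * √(1 + S.Y t) := by
  have hθc := S.jointSmooth_θ.continuous_space s
  have hY := S.Y_nonneg (hs.1.trans hs.2)
  have hE0 : 0 ≤ E := (S.tInt_θ_nonneg s).trans hE
  set l := √(1 + S.Y t) with hl
  have hl1 : 1 ≤ l := by rw [hl, one_le_sqrt]; linarith
  have hl2 : l * l = 1 + S.Y t := mul_self_sqrt (by linarith)
  obtain ⟨y, hy, hyE⟩ : ∃ y ∈ Icc (-(1 / 2) : ℝ) (1 / 2), S.θ s y ≤ E + 1 := by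
    by_contra! hcon
    have := tInt_mono continuous_const hθc fun y hy => (hcon y hy).le
    rw [tInt_const] at this
    linarith
  have hd : ∀ z ∈ uIcc y x, HasDerivAt (fun z => S.θ s z ^ (β + 3 / 2))
      ((β + 3 / 2) * (S.θ s z ^ (β + 1 / 2) * px S.θ s z)) z := by
    intro z _
    convert (S.jointSmooth_θ.hasDerivAt_space s z).rpow_const (p := β + 3 / 2)
      (Or.inl (S.θ_pos s z).ne') using 1
    rw [show β + 3 / 2 - 1 = β + 1 / 2 by ring]
    ring
  have hgS := (S.jointSmooth_θ.rpow S.θ_pos (β + 1 / 2)).mul S.jointSmooth_θ.px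
  have hg := hgS.continuous_space s
  have hKc := (((S.jointSmooth_kappa.pow 2).mul (S.jointSmooth_θ.px.pow 2)).div
    (S.jointSmooth_v.pow 2) fun t x => pow_pos (S.v_pos t x) 2).continuous_space s
  have h1 := intervalIntegral.integral_eq_sub_of_hasDerivAt hd
    ((hg.const_mul (β + 3 / 2)).intervalIntegrable _ _)
  rw [intervalIntegral.integral_const_mul] at h1
  have h2 : ∫ z in y..x, S.θ s z ^ (β + 1 / 2) * px S.θ s z ≤ l * E + (κ₂ ^ 2 * l)⁻¹ * S.Y t :=
    calc ∫ z in y..x, S.θ s z ^ (β + 1 / 2) * px S.θ s z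
        ≤ abs (∫ z in y..x, S.θ s z ^ (β + 1 / 2) * px S.θ s z) := le_abs_self _
      _ ≤ tInt fun z => |S.θ s z ^ (β + 1 / 2) * px S.θ s z| := abs_integral_le_tInt hg hx hy
      _ ≤ tInt fun z => l * S.θ s z + (κ₂ ^ 2 * l)⁻¹ *
          (kappa κ₁ κ₂ β (S.v s z) (S.θ s z) ^ 2 * px S.θ s z ^ 2 / S.v s z ^ 2) :=
          tInt_mono hg.abs ((hθc.const_mul l).add (hKc.const_mul _)) fun z _ =>
            S.abs_rpow_mul_px_le hκ₁ hκ₂ (by linarith) s z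
      _ ≤ l * E + (κ₂ ^ 2 * l)⁻¹ * S.Y t := by
          rw [tInt_add (hθc.const_mul l) (hKc.const_mul _), tInt_const_mul, tInt_const_mul]
          have := S.le_Y hs
          gcongr
  have h3 : (κ₂ ^ 2 * l)⁻¹ * S.Y t ≤ (κ₂ ^ 2)⁻¹ * l := by
    rw [mul_inv, mul_assoc]
    gcongr
    rw [inv_mul_le_iff₀ (by linarith)]
    linarith
  have h4 : S.θ s y ^ (β + 3 / 2) ≤ (E + 1) ^ (β + 3 / 2) :=
    rpow_le_rpow (S.θ_pos s y).le hyE (by linarith)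
  have h5 : (E + 1) ^ (β + 3 / 2) ≤ (E + 1) ^ (β + 3 / 2) * l :=
    le_mul_of_one_le_right (rpow_nonneg (by linarith) _) hl1
  have h6 : (β + 3 / 2) * ∫ z in y..x, S.θ s z ^ (β + 1 / 2) * px S.θ s z
      ≤ (β + 3 / 2) * (l * E + (κ₂ ^ 2)⁻¹ * l) :=
    mul_le_mul_of_nonneg_left (by linarith) (by linarith)
  linarith

/-- The pointwise bound of the temperature by a power of `𝔜`. -/
theorem exists_θ_upper_bound (hR : 0 < R) (hγ : 1 < γ) (hκ₁ : 0 < κ₁) (hκ₂ : 0 < κ₂) (hβ : 0 < β)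
    (M ε : ℝ) (hM : 1 ≤ M) :
    ∃ K : ℝ, 1 ≤ K ∧ ∀ S : Sol μ R a b κ₁ κ₂ β γ T, S.Bounded M ε → ∀ t ∈ Icc 0 T,
      ∀ s ∈ Icc 0 t, ∀ x ∈ Icc (-(1 / 2) : ℝ) (1 / 2),
        S.θ s x ≤ K * (1 + S.Y t) ^ (1 / (2 * β + 3)) := by
  obtain ⟨E, hE, hb⟩ := exists_energy_bound (μ := μ) (a := a) (b := b) (κ₁ := κ₁) (κ₂ := κ₂)
    (β := β) (T := T) hR hγ M ε hM
  set A := (E + 1) ^ (β + 3 / 2) + (β + 3 / 2) * (E + (κ₂ ^ 2)⁻¹) with hA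
  have hA0 : 0 < A := by positivity
  refine ⟨max 1 (A ^ (1 / (β + 3 / 2))), le_max_left _ _, fun S hS t ht s hs x hx => ?_⟩
  have hY := S.Y_nonneg ht.1
  have h := S.θ_rpow_le hκ₁ hκ₂ hβ hs (hb S hS s ⟨hs.1, hs.2.trans ht.2⟩).1 hx
  have hm : 0 < β + 3 / 2 := by linarith
  calc S.θ s x = (S.θ s x ^ (β + 3 / 2)) ^ (1 / (β + 3 / 2)) := by
        rw [← rpow_mul (S.θ_pos s x).le, mul_one_div_cancel hm.ne', rpow_one]
    _ ≤ (A * √(1 + S.Y t)) ^ (1 / (β + 3 / 2)) :=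
        rpow_le_rpow (rpow_nonneg (S.θ_pos s x).le _) h (by positivity)
    _ = A ^ (1 / (β + 3 / 2)) * (1 + S.Y t) ^ (1 / (2 * β + 3)) := by
        rw [mul_rpow hA0.le (sqrt_nonneg _), sqrt_eq_rpow, ← rpow_mul (by linarith)]
        congr 2
        field_simp
    _ ≤ _ := by
        gcongr
        exact le_max_right _ _

end Sol

namespace Sol

variable {μ R a b κ₁ κ₂ β γ T : ℝ} (S : Sol μ R a b κ₁ κ₂ β γ T)

/-- The pointwise inequality behind the temperature estimate, for a temperature below `Θ`. -/
theorem pt_add_dissipation_le (hμ : 0 < μ) (ha : 0 < a) {s x c Θ : ℝ}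
    (hs : s ∈ Icc 0 T) (hc : 0 < c) (hv : c ≤ S.v s x) (hΘ : 1 ≤ Θ) (hθ : S.θ s x ≤ Θ) :
    pt (fun s y => R / (γ - 1) / 2 * S.θ s y ^ 2 + Θ / 2 * S.u s y ^ 2) s x
        + kappa κ₁ κ₂ β (S.v s x) (S.θ s x) * px S.θ s x ^ 2 / S.v s x
      ≤ px (fun s y => S.θ s y * S.heat s y + Θ * (S.u s y * (S.visc s y - S.press s y))
          + S.q s y * S.rad s y - b * (S.q s y * S.θ s y ^ 4)) s x
        + Θ ^ 8 * (R ^ 2 / (4 * μ * c) + (b ^ 2 + 1) * S.v s x) := by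
  have hu := S.jointSmooth_u.hasDerivAt_space s x
  have hp := S.jointSmooth_press.hasDerivAt_space s x
  have hw := S.jointSmooth_visc.hasDerivAt_space s x
  have hh := S.jointSmooth_heat.hasDerivAt_space s x
  have hq := S.jointSmooth_q.hasDerivAt_space s x
  have hr := S.jointSmooth_rad.hasDerivAt_space s x
  have hθx := S.jointSmooth_θ.hasDerivAt_space s x
  have hθ4 := (S.jointSmooth_θ.pow 4).hasDerivAt_space s x
  have hv0 := S.v_pos s x
  have hθ0 := S.θ_pos s x
  have e1 : pt (fun s y => R / (γ - 1) / 2 * S.θ s y ^ 2 + Θ / 2 * S.u s y ^ 2) s x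
      = R / (γ - 1) / 2 * ((2 : ℕ) * S.θ s x ^ (2 - 1) * pt S.θ s x)
        + Θ / 2 * ((2 : ℕ) * S.u s x ^ (2 - 1) * pt S.u s x) :=
    ((((S.jointSmooth_θ.hasDerivAt_time s x).pow 2).const_mul (R / (γ - 1) / 2)).add
      (((S.jointSmooth_u.hasDerivAt_time s x).pow 2).const_mul (Θ / 2))).deriv
  have e2 : px (fun s y => S.θ s y * S.heat s y + Θ * (S.u s y * (S.visc s y - S.press s y))
        + S.q s y * S.rad s y - b * (S.q s y * S.θ s y ^ 4)) s x
      = px S.θ s x * S.heat s x + S.θ s x * px S.heat s x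
        + Θ * (px S.u s x * (S.visc s x - S.press s x)
          + S.u s x * (px S.visc s x - px S.press s x))
        + (px S.q s x * S.rad s x + S.q s x * px S.rad s x)
        - b * (px S.q s x * S.θ s x ^ 4 + S.q s x * px (fun s y => S.θ s y ^ 4) s x) :=
    ((((hθx.mul hh).add ((hu.mul (hw.sub hp)).const_mul Θ)).add (hq.mul hr)).sub
      ((hq.mul hθ4).const_mul b)).deriv
  have e3 : px S.rad s x = a * S.v s x * S.q s x + b * px (fun s y => S.θ s y ^ 4) s x := by
    have h := S.eq_rad s hs x
    change -px S.rad s x + a * S.v s x * S.q s x + b * px (fun s y => S.θ s y ^ 4) s x = 0 at h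
    linarith
  have e4 : px S.θ s x * S.heat s x
      = kappa κ₁ κ₂ β (S.v s x) (S.θ s x) * px S.θ s x ^ 2 / S.v s x := by
    rw [heat]; ring
  have e5 := S.pt_θ_eq hs x
  have hvisc : -((Θ - S.θ s x) * (px S.u s x * (S.visc s x - S.press s x)))
      ≤ Θ ^ 8 * (R ^ 2 / (4 * μ * c)) := by
    have h1 : -(px S.u s x * (S.visc s x - S.press s x))
        ≤ R ^ 2 * S.θ s x ^ 2 / (4 * μ * S.v s x) := by
      have : R ^ 2 * S.θ s x ^ 2 / (4 * μ * S.v s x)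
          + px S.u s x * (S.visc s x - S.press s x)
          = (2 * μ * px S.u s x - R * S.θ s x) ^ 2 / (4 * μ * S.v s x) := by
        rw [visc, press]
        field_simp
        ring
      have h2 : 0 ≤ (2 * μ * px S.u s x - R * S.θ s x) ^ 2 / (4 * μ * S.v s x) := by positivity
      linarith
    have h3 : R ^ 2 * S.θ s x ^ 2 / (4 * μ * S.v s x) ≤ R ^ 2 * Θ ^ 2 / (4 * μ * c) := by
      gcongr
    calc -((Θ - S.θ s x) * (px S.u s x * (S.visc s x - S.press s x)))
        = (Θ - S.θ s x) * -(px S.u s x * (S.visc s x - S.press s x)) := by ring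
      _ ≤ (Θ - S.θ s x) * (R ^ 2 * Θ ^ 2 / (4 * μ * c)) :=
          mul_le_mul_of_nonneg_left (h1.trans h3) (sub_nonneg.2 hθ)
      _ ≤ Θ * (R ^ 2 * Θ ^ 2 / (4 * μ * c)) := by gcongr; linarith
      _ = Θ ^ 3 * (R ^ 2 / (4 * μ * c)) := by ring
      _ ≤ Θ ^ 8 * (R ^ 2 / (4 * μ * c)) := by gcongr; norm_num
  have hrad : -(S.θ s x * px S.q s x) - px S.q s x * S.rad s x + b * (px S.q s x * S.θ s x ^ 4)
      ≤ Θ ^ 8 * ((b ^ 2 + 1) * S.v s x) := by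
    have h1 : -(S.θ s x * px S.q s x) - px S.q s x * S.rad s x + b * (px S.q s x * S.θ s x ^ 4)
        ≤ S.v s x * (b * S.θ s x ^ 4 - S.θ s x) ^ 2 / 4 := by
      have : S.v s x * (b * S.θ s x ^ 4 - S.θ s x) ^ 2 / 4
          - (-(S.θ s x * px S.q s x) - px S.q s x * S.rad s x + b * (px S.q s x * S.θ s x ^ 4))
          = (2 * px S.q s x - S.v s x * (b * S.θ s x ^ 4 - S.θ s x)) ^ 2 / (4 * S.v s x) := by
        rw [rad]
        field_simp
        ring
      have h2 : 0 ≤ (2 * px S.q s x - S.v s x * (b * S.θ s x ^ 4 - S.θ s x)) ^ 2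
          / (4 * S.v s x) := by positivity
      linarith
    have h8 : S.θ s x ^ 8 ≤ Θ ^ 8 := by gcongr
    have h2 : S.θ s x ^ 2 ≤ Θ ^ 8 :=
      (pow_le_pow_left₀ hθ0.le hθ 2).trans (pow_le_pow_right₀ hΘ (by norm_num))
    have h3 : (b * S.θ s x ^ 4 - S.θ s x) ^ 2 / 4 ≤ (b ^ 2 + 1) * Θ ^ 8 := by
      have h4 : b ^ 2 * S.θ s x ^ 8 ≤ b ^ 2 * Θ ^ 8 := by gcongr
      have h5 : 0 ≤ b ^ 2 * Θ ^ 8 := by positivity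
      have h6 : 0 ≤ Θ ^ 8 := by positivity
      nlinarith [sq_nonneg (b * S.θ s x ^ 4 + S.θ s x)]
    calc _ ≤ S.v s x * (b * S.θ s x ^ 4 - S.θ s x) ^ 2 / 4 := h1
      _ = S.v s x * ((b * S.θ s x ^ 4 - S.θ s x) ^ 2 / 4) := by ring
      _ ≤ S.v s x * ((b ^ 2 + 1) * Θ ^ 8) := by gcongr
      _ = _ := by ring
  have habs : 0 ≤ a * S.v s x * S.q s x ^ 2 := by positivity
  rw [e1, e2, e3, e4, S.pt_u_eq hs x]
  norm_num
  linear_combination S.θ s x * e5 + hvisc + hrad + habs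

theorem L2sq_θ_add_dissipation_le (hμ : 0 < μ) (ha : 0 < a) {t c Θ : ℝ} (ht : t ∈ Icc 0 T)
    (hc : 0 < c) (hΘ : 1 ≤ Θ)
    (hv : ∀ s ∈ Icc 0 t, ∀ x ∈ Icc (-(1 / 2) : ℝ) (1 / 2), c ≤ S.v s x)
    (hθ : ∀ s ∈ Icc 0 t, ∀ x ∈ Icc (-(1 / 2) : ℝ) (1 / 2), S.θ s x ≤ Θ) :
    R / (γ - 1) / 2 * L2sq (S.θ t) + (∫ s in (0 : ℝ)..t, tInt fun x =>
        kappa κ₁ κ₂ β (S.v s x) (S.θ s x) * px S.θ s x ^ 2 / S.v s x)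
      ≤ R / (γ - 1) / 2 * L2sq (S.θ 0) + Θ / 2 * L2sq (S.u 0)
        + t * (Θ ^ 8 * (R ^ 2 / (4 * μ * c) + (b ^ 2 + 1))) := by
  have hF : JointSmooth fun s y => R / (γ - 1) / 2 * S.θ s y ^ 2 + Θ / 2 * S.u s y ^ 2 :=
    ((JointSmooth.const _).mul (S.jointSmooth_θ.pow 2)).add
      ((JointSmooth.const _).mul (S.jointSmooth_u.pow 2))
  have hG : JointSmooth fun s y =>
      S.θ s y * S.heat s y + Θ * (S.u s y * (S.visc s y - S.press s y))
        + S.q s y * S.rad s y - b * (S.q s y * S.θ s y ^ 4) :=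
    (((S.jointSmooth_θ.mul S.jointSmooth_heat).add ((JointSmooth.const Θ).mul
      (S.jointSmooth_u.mul (S.jointSmooth_visc.sub S.jointSmooth_press)))).add
      (S.jointSmooth_q.mul S.jointSmooth_rad)).sub
      ((JointSmooth.const b).mul (S.jointSmooth_q.mul (S.jointSmooth_θ.pow 4)))
  have hD : JointSmooth fun s x =>
      kappa κ₁ κ₂ β (S.v s x) (S.θ s x) * px S.θ s x ^ 2 / S.v s x :=
    (S.jointSmooth_kappa.mul (S.jointSmooth_θ.px.pow 2)).div S.jointSmooth_v S.v_pos
  have hslice : ∀ s ∈ Icc 0 t,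
      tInt (pt (fun s y => R / (γ - 1) / 2 * S.θ s y ^ 2 + Θ / 2 * S.u s y ^ 2) s)
        + tInt (fun x => kappa κ₁ κ₂ β (S.v s x) (S.θ s x) * px S.θ s x ^ 2 / S.v s x)
      ≤ Θ ^ 8 * (R ^ 2 / (4 * μ * c) + (b ^ 2 + 1)) := by
    intro s hs
    have hsT : s ∈ Icc 0 T := ⟨hs.1, hs.2.trans ht.2⟩
    have hvc := S.jointSmooth_v.continuous_space s
    have hGc := hG.px.continuous_space s
    have hFc := hF.pt.continuous_space s
    have hDc := hD.continuous_space s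
    have hper : tInt (px (fun s y =>
        S.θ s y * S.heat s y + Θ * (S.u s y * (S.visc s y - S.press s y))
        + S.q s y * S.rad s y - b * (S.q s y * S.θ s y ^ 4)) s) = 0 := by
      refine hG.tInt_px_eq_zero fun x => ?_
      simp only [S.periodic_θ s x, S.periodic_u s x, S.periodic_q s x, S.periodic_heat s x,
        S.periodic_visc s x, S.periodic_press s x, S.periodic_rad s x]
    have h := tInt_mono (hFc.add hDc)
      (hGc.add (g := fun x => Θ ^ 8 * (R ^ 2 / (4 * μ * c) + (b ^ 2 + 1) * S.v s x))
        (by fun_prop)) fun x hx =>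
      S.pt_add_dissipation_le hμ ha hsT hc (hv s hs x hx) hΘ (hθ s hs x hx)
    have h1 := tInt_add hFc hDc
    have h2 := tInt_add hGc
      (g := fun x => Θ ^ 8 * (R ^ 2 / (4 * μ * c) + (b ^ 2 + 1) * S.v s x)) (by fun_prop)
    rw [tInt_const_mul, tInt_add continuous_const (hvc.const_mul _), tInt_const, tInt_const_mul,
      S.tInt_v hsT, hper, mul_one, zero_add] at h2
    exact h1.symm.le.trans (h.trans h2.le)
  have htime := intervalIntegral.integral_mono_on (μ := volume) ht.1
    ((hF.pt.continuous_tInt.add hD.continuous_tInt).intervalIntegrable 0 t)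
    (continuous_const.intervalIntegrable 0 t) hslice
  have e1 : ∫ s in (0 : ℝ)..t,
      (tInt (pt (fun s y => R / (γ - 1) / 2 * S.θ s y ^ 2 + Θ / 2 * S.u s y ^ 2) s)
        + tInt (fun x => kappa κ₁ κ₂ β (S.v s x) (S.θ s x) * px S.θ s x ^ 2 / S.v s x))
      = _ := intervalIntegral.integral_add (hF.pt.continuous_tInt.intervalIntegrable _ _)
        (hD.continuous_tInt.intervalIntegrable _ _)
  have e2 : ∀ s, tInt (fun y => R / (γ - 1) / 2 * S.θ s y ^ 2 + Θ / 2 * S.u s y ^ 2)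
      = R / (γ - 1) / 2 * L2sq (S.θ s) + Θ / 2 * L2sq (S.u s) := by
    intro s
    have hθc := S.jointSmooth_θ.continuous_space s
    have huc := S.jointSmooth_u.continuous_space s
    rw [tInt_add (by fun_prop) (by fun_prop), tInt_const_mul, tInt_const_mul]
    rfl
  have hmain := e1.symm.le.trans htime
  rw [hF.integral_tInt_pt, e2, e2, intervalIntegral.integral_const, smul_eq_mul, sub_zero] at hmain
  have h0 : 0 ≤ Θ / 2 * L2sq (S.u t) := mul_nonneg (by linarith) (L2sq_nonneg _)
  linarith

end Sol

theorem one_add_rpow_le {y p : ℝ} (hy : 0 ≤ y) (hp : 0 ≤ p) :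
    (1 + y) ^ p ≤ 2 ^ p * (1 + y ^ p) := by
  have h0 := rpow_nonneg hy p
  have h2 : (0 : ℝ) ≤ 2 ^ p := rpow_nonneg (by norm_num) p
  rcases le_total y 1 with h | h
  · calc (1 + y) ^ p ≤ 2 ^ p := rpow_le_rpow (by linarith) (by linarith) hp
      _ ≤ _ := le_mul_of_one_le_right h2 (by linarith)
  · calc (1 + y) ^ p ≤ (2 * y) ^ p := rpow_le_rpow (by linarith) (by linarith) hp
      _ = 2 ^ p * y ^ p := mul_rpow (by norm_num) hy
      _ ≤ _ := by gcongr; linarith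

end RadHydro


theorem stmt_9 (μ R a b κ₁ κ₂ β γ : ℝ)
    (hμ : 0 < μ) (hR : 0 < R) (ha : 0 < a) (hb : 0 < b)
    (hκ₁ : 0 < κ₁) (hκ₂ : 0 < κ₂) (hβ : 0 < β) (hγ : 1 < γ)
    (T M ε : ℝ) (hT : 0 < T) (hM : 1 ≤ M) (hε0 : 0 < ε) (hε1 : ε ≤ 1) :
    ∃ C : ℝ, 0 < C ∧
      ∀ S : Sol μ R a b κ₁ κ₂ β γ T, S.Bounded M ε →
        ∀ t ∈ Icc (0 : ℝ) T,
          L2sq (S.θ t) + (∫ s in (0 : ℝ)..t, tInt fun x =>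
              kappa κ₁ κ₂ β (S.v s x) (S.θ s x) * (px S.θ s x) ^ 2 / S.v s x)
            ≤ C * (1 + S.Y t ^ (8 / (2 * β + 3))) := by
  obtain ⟨c, hc, hv⟩ := Sol.exists_v_lower_bound (a := a) (b := b) (κ₁ := κ₁) (κ₂ := κ₂) (β := β)
    (T := T) hμ hR hγ M ε hM hε0
  obtain ⟨K, hK, hθ⟩ := Sol.exists_θ_upper_bound (μ := μ) (a := a) (b := b) (T := T)
    hR hγ hκ₁ hκ₂ hβ M ε hM
  have hk : 0 < R / (γ - 1) / 2 := half_pos (div_pos hR (by linarith))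
  set k := R / (γ - 1) / 2 with hkdef
  set L := k * M ^ 2 + M ^ 2 / 2 + T * (R ^ 2 / (4 * μ * c) + (b ^ 2 + 1)) with hL
  set p := 8 / (2 * β + 3) with hp
  have hp0 : 0 ≤ p := by positivity
  have hM0 : 0 < M := by linarith
  have hK0 : 0 < K := by linarith
  refine ⟨(1 / k + 1) * (K ^ 8 * 2 ^ p * L), by positivity, fun S hS t ht => ?_⟩
  have hY := S.Y_nonneg ht.1
  set Θ := K * (1 + S.Y t) ^ (1 / (2 * β + 3)) with hΘdef
  have hΘ : 1 ≤ Θ := one_le_mul_of_one_le_of_one_le hK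
    (one_le_rpow (by linarith) (by positivity))
  have hΘ8 : Θ ^ 8 ≤ K ^ 8 * 2 ^ p * (1 + S.Y t ^ p) := by
    have e : ((1 + S.Y t) ^ (1 / (2 * β + 3))) ^ 8 = (1 + S.Y t) ^ p := by
      rw [← rpow_natCast, ← rpow_mul (by linarith), hp]
      congr 1
      push_cast
      ring
    rw [hΘdef, mul_pow, e, mul_assoc]
    gcongr
    exact one_add_rpow_le hY hp0
  have h := S.L2sq_θ_add_dissipation_le hμ ha ht hc hΘ
    (fun s hs x hx => hv S hS s ⟨hs.1, hs.2.trans ht.2⟩ x hx) (fun s hs x hx => hθ S hS t ht s hs x hx)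
  rw [← hkdef] at h
  obtain ⟨hu0, hθ0⟩ := hS.L2sq_le hM0.le
  set D := ∫ s in (0 : ℝ)..t, tInt fun x =>
    kappa κ₁ κ₂ β (S.v s x) (S.θ s x) * (px S.θ s x) ^ 2 / S.v s x with hD
  have hD0 : 0 ≤ D := by
    refine intervalIntegral.integral_nonneg ht.1 fun s _ => tInt_nonneg fun x => ?_
    have h1 := S.v_pos s x
    have h2 := S.θ_pos s x
    unfold kappa
    positivity
  have hΘ1 : 1 ≤ Θ ^ 8 := one_le_pow₀ hΘ
  have hΘ2 : Θ ≤ Θ ^ 8 := le_self_pow₀ hΘ (by norm_num)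
  have hbound : k * L2sq (S.θ t) + D ≤ Θ ^ 8 * L := by
    have h1 : k * L2sq (S.θ 0) ≤ Θ ^ 8 * (k * M ^ 2) :=
      (mul_le_mul_of_nonneg_left hθ0 hk.le).trans (le_mul_of_one_le_left (by positivity) hΘ1)
    have h2 : Θ / 2 * L2sq (S.u 0) ≤ Θ ^ 8 * (M ^ 2 / 2) :=
      calc Θ / 2 * L2sq (S.u 0) ≤ Θ / 2 * M ^ 2 := by gcongr
        _ = Θ * (M ^ 2 / 2) := by ring
        _ ≤ _ := by gcongr
    have h3 : t * (Θ ^ 8 * (R ^ 2 / (4 * μ * c) + (b ^ 2 + 1)))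
        ≤ Θ ^ 8 * (T * (R ^ 2 / (4 * μ * c) + (b ^ 2 + 1))) := by
      have := ht.2
      calc _ ≤ T * (Θ ^ 8 * (R ^ 2 / (4 * μ * c) + (b ^ 2 + 1))) := by gcongr
        _ = _ := by ring
    rw [hL, mul_add, mul_add]
    linarith
  have hL0 : 0 < L := by positivity
  have hN := L2sq_nonneg (S.θ t)
  calc L2sq (S.θ t) + D ≤ (1 / k + 1) * (k * L2sq (S.θ t) + D) := by
        have h1 : (1 / k + 1) * (k * L2sq (S.θ t) + D)
            = L2sq (S.θ t) + D + (k * L2sq (S.θ t) + 1 / k * D) := by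
          field_simp
          ring
        have h2 : 0 ≤ k * L2sq (S.θ t) + 1 / k * D := by positivity
        linarith
    _ ≤ (1 / k + 1) * (K ^ 8 * 2 ^ p * (1 + S.Y t ^ p) * L) := by
        gcongr
        exact hbound.trans (mul_le_mul_of_nonneg_right hΘ8 hL0.le)
    _ = _ := by ring
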